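/- arXiv:2508.07762 — 5 statements merged into one kernel-verified Lean document; each statement's English description precedes it below -/
import Mathlib

section
/- Let d ≥ 2 be an integer, k > 0, and set l_k := π/(2√k). Let ν be a finite Borel measure on the interval (0, l_k]. Then for every r ∈ [0, l_k): ∫_{(0,l_k]} ∫_{−R}^{R} 1{α_k(R,h) > r} · cos^{d−1}(√k·h) dh dν(R) = ∫_{(r,l_k]} ∫_{−α_k(R,r)}^{α_k(R,r)} cos^{d−1}(√k·h) dh dν(R). (This is the analytic core of the section formula for spaces of positive constant curvature.) -/
open MeasureTheory Real

/-- Section radius in spherical space of curvature `k > 0`: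
`α_k(t,h) = (1/√k) · arccos(cos(√k·t)/cos(√k·h))`. -/
noncomputable def alphaPos (k t h : ℝ) : ℝ :=
  (1 / Real.sqrt k) * Real.arccos (Real.cos (Real.sqrt k * t) / Real.cos (Real.sqrt k * h))

/-- Characterization of lower bounds on `arccos` by the cosine. -/
theorem lt_arccos_iff {x y : ℝ} (hx0 : 0 ≤ x) (hxπ : x ≤ Real.pi) (hy1 : -1 ≤ y) (hy2 : y ≤ 1) :
    x < Real.arccos y ↔ y < Real.cos x := by
  have h := Real.strictAntiOn_arccos.lt_iff_gt
    (⟨Real.neg_one_le_cos x, Real.cos_le_one x⟩ : Real.cos x ∈ Set.Icc (-1) 1)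
    (⟨hy1, hy2⟩ : y ∈ Set.Icc (-1) 1)
  rwa [Real.arccos_cos hx0 hxπ] at h

/-- The cosine form of `y < alphaPos k t h`, in the range where the section radius is geometric. -/
theorem lt_alphaPos_iff {k t h y : ℝ} (hk : 0 < k) (hht : |h| ≤ t)
    (ht : Real.sqrt k * t ≤ Real.pi / 2) (hh : Real.sqrt k * |h| < Real.pi / 2)
    (hy0 : 0 ≤ y) (hy : Real.sqrt k * y ≤ Real.pi / 2) :
    y < alphaPos k t h ↔
      Real.cos (Real.sqrt k * t) < Real.cos (Real.sqrt k * y) * Real.cos (Real.sqrt k * h) := by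
  have hs : 0 < Real.sqrt k := Real.sqrt_pos.2 hk
  have hpi := Real.pi_pos
  have habs : Real.cos (Real.sqrt k * |h|) = Real.cos (Real.sqrt k * h) := by
    rw [← Real.cos_abs (Real.sqrt k * h), abs_mul, abs_of_pos hs]
  have hst : Real.sqrt k * |h| ≤ Real.sqrt k * t := by gcongr
  have hsh : 0 ≤ Real.sqrt k * |h| := by positivity
  have hcos : 0 < Real.cos (Real.sqrt k * h) := by
    rw [← habs]
    exact Real.cos_pos_of_mem_Ioo ⟨by linarith, hh⟩
  have hle : Real.cos (Real.sqrt k * t) ≤ Real.cos (Real.sqrt k * h) := by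
    rw [← habs]
    exact Real.cos_le_cos_of_nonneg_of_le_pi hsh (by linarith) hst
  have hct : 0 ≤ Real.cos (Real.sqrt k * t) :=
    Real.cos_nonneg_of_mem_Icc ⟨by linarith, ht⟩
  have hq : 0 ≤ Real.cos (Real.sqrt k * t) / Real.cos (Real.sqrt k * h) := by positivity
  rw [alphaPos, one_div_mul_eq_div, lt_div_iff₀ hs, mul_comm y,
    lt_arccos_iff (by positivity) (by linarith) (by linarith) ((div_le_one hcos).2 hle),
    div_lt_iff₀ hcos]

theorem alphaPos_nonneg (k t h : ℝ) : 0 ≤ alphaPos k t h :=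
  mul_nonneg (by positivity) (Real.arccos_nonneg _)

/-- A section does not have larger radius than the ball itself. -/
theorem alphaPos_le {k t h : ℝ} (hk : 0 < k) (hht : |h| ≤ t)
    (ht : Real.sqrt k * t ≤ Real.pi / 2) (hh : Real.sqrt k * |h| < Real.pi / 2) :
    alphaPos k t h ≤ t := by
  have ht0 : 0 ≤ t := (abs_nonneg h).trans hht
  rw [← not_lt, lt_alphaPos_iff hk hht ht hh ht0 ht, not_lt]
  have hct : 0 ≤ Real.cos (Real.sqrt k * t) :=
    Real.cos_nonneg_of_mem_Icc
      ⟨by linarith [Real.pi_pos, show 0 ≤ Real.sqrt k * t by positivity], ht⟩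
  exact mul_le_of_le_one_right hct (Real.cos_le_one _)

/-- A ball of radius at most `r` has no section of radius greater than `r`. -/
theorem integral_section_eq_zero {k r R : ℝ} (f : ℝ → ℝ) (hk : 0 < k) (hR0 : 0 ≤ R) (hRr : R ≤ r)
    (hr : Real.sqrt k * r < Real.pi / 2) :
    ∫ h in (-R)..R, (if r < alphaPos k R h then f h else 0) = 0 := by
  have hsR : Real.sqrt k * R ≤ Real.sqrt k * r := by gcongr
  refine (intervalIntegral.integral_congr fun h hh => ?_).trans intervalIntegral.integral_zero
  rw [Set.uIcc_of_le (by linarith)] at hh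
  have hhR : |h| ≤ R := abs_le.2 hh
  have hsh : Real.sqrt k * |h| ≤ Real.sqrt k * R := by gcongr
  refine if_neg (not_lt.2 ?_)
  exact (alphaPos_le hk hhR (by linarith) (by linarith)).trans hRr

/-- Sections of radius greater than `r` are those at distance less than `alphaPos k R r`. -/
theorem integral_section_eq {k r R : ℝ} (f : ℝ → ℝ) (hk : 0 < k) (hr0 : 0 ≤ r) (hrR : r < R)
    (hR : Real.sqrt k * R ≤ Real.pi / 2) :
    ∫ h in (-R)..R, (if r < alphaPos k R h then f h else 0)
      = ∫ h in (-(alphaPos k R r))..(alphaPos k R r), f h := by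
  have hs : 0 < Real.sqrt k := Real.sqrt_pos.2 hk
  have hsr : Real.sqrt k * r < Real.sqrt k * R := by gcongr
  have habs : |r| = r := abs_of_nonneg hr0
  have ha0 : 0 ≤ alphaPos k R r := alphaPos_nonneg k R r
  have haR : alphaPos k R r ≤ R :=
    alphaPos_le hk (by rw [habs]; exact hrR.le) hR (by rw [habs]; linarith)
  have hiff : ∀ h ∈ Set.Ioo (-R) R,
      (r < alphaPos k R h ↔ h ∈ Set.Ioo (-(alphaPos k R r)) (alphaPos k R r)) := by
    intro h hh
    have hhR : |h| < R := abs_lt.2 hh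
    have hsh : Real.sqrt k * |h| < Real.sqrt k * R := by gcongr
    have hcos : Real.cos (Real.sqrt k * |h|) = Real.cos (Real.sqrt k * h) := by
      rw [← Real.cos_abs (Real.sqrt k * h), abs_mul, abs_of_pos hs]
    rw [Set.mem_Ioo, ← abs_lt, lt_alphaPos_iff hk hhR.le hR (by linarith) hr0 (by linarith),
      lt_alphaPos_iff hk (by rw [habs]; exact hrR.le) hR (by rw [habs]; linarith)
        (abs_nonneg h) (by linarith), hcos,
      mul_comm (Real.cos (Real.sqrt k * r))]
  rw [intervalIntegral.integral_of_le (by linarith), intervalIntegral.integral_of_le (by linarith),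
    integral_Ioc_eq_integral_Ioo, integral_Ioc_eq_integral_Ioo]
  have hind : ∀ h ∈ Set.Ioo (-R) R, (if r < alphaPos k R h then f h else 0)
      = (Set.Ioo (-(alphaPos k R r)) (alphaPos k R r)).indicator f h := by
    intro h hh
    rw [Set.indicator_apply]
    exact if_congr (hiff h hh) rfl rfl
  rw [setIntegral_congr_fun measurableSet_Ioo hind, setIntegral_indicator measurableSet_Ioo,
    Set.inter_eq_right.2 (Set.Ioo_subset_Ioo (by linarith) haR)]

/-- Analytic core of the section formula for spaces of positive constant curvature. -/
theorem wicksell_section_core_pos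
    (d : ℕ) (hd : 2 ≤ d) (k : ℝ) (hk : 0 < k)
    (lk : ℝ) (hlk : lk = Real.pi / (2 * Real.sqrt k))
    (ν : Measure ℝ) [IsFiniteMeasure ν] (hν : ν (Set.Ioc 0 lk)ᶜ = 0)
    (r : ℝ) (hr0 : 0 ≤ r) (hrlk : r < lk) :
    ∫ R in Set.Ioc (0 : ℝ) lk,
        (∫ h in (-R)..R,
          (if r < alphaPos k R h then Real.cos (Real.sqrt k * h) ^ (d - 1) else 0)) ∂ν
      = ∫ R in Set.Ioc r lk,
          (∫ h in (-(alphaPos k R r))..(alphaPos k R r),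
            Real.cos (Real.sqrt k * h) ^ (d - 1)) ∂ν := by
  have hs : 0 < Real.sqrt k := Real.sqrt_pos.2 hk
  have hslk : Real.sqrt k * lk = Real.pi / 2 := by
    rw [hlk]
    field_simp
  have hsr : Real.sqrt k * r < Real.pi / 2 := by
    rw [← hslk]
    gcongr
  rw [setIntegral_eq_of_subset_of_forall_sdiff_eq_zero measurableSet_Ioc
    (Set.Ioc_subset_Ioc_left hr0) fun R hR =>
      integral_section_eq_zero _ hk hR.1.1.le
        (not_lt.1 fun hlt => hR.2 ⟨hlt, hR.1.2⟩) hsr]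
  refine setIntegral_congr_fun measurableSet_Ioc fun R hR => ?_
  refine integral_section_eq _ hk hr0 hR.1 ?_
  rw [← hslk]
  exact mul_le_mul_of_nonneg_left hR.2 hs.le
end

section
/- (Inversion formula for spaces of positive curvature.) Let d ≥ 2 be an integer, k > 0, and set l_k := π/(2√k). Let ν_d and ν_{d−1} be Borel probability measures on (0, l_k], let c := ∫_{(0,l_k]} ∫_{−R}^{R} cos^{d−1}(√k·h) dh dν_d(R), and assume that for every r ∈ [0, l_k): c·ν_{d−1}((r,l_k]) = ∫_{(r,l_k]} ∫_{−α_k(R,r)}^{α_k(R,r)} cos^{d−1}(√k·h) dh dν_d(R). Then for every a ∈ (0, l_k): ν_d((a, l_k]) = (c·√k/π) · [ cos^{2−d}(√k·a) · ∫_{(a,l_k]} cos^{d−1}(√k·y) · (cos²(√k·a) − cos²(√k·y))^{−1/2} dν_{d−1}(y) + (d−1) · ∫_{(a,l_k]} ∫_0^{arccos(cos(√k·y)/cos(√k·a))} cos^{d−2}θ dθ dν_{d−1}(y) ]. -/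
open MeasureTheory Real

lemma lt_arccos_iff_lt_cos {θ x : ℝ} (h0 : 0 ≤ θ) (hπ : θ < π) :
    θ < arccos x ↔ x < cos θ := by
  constructor
  · intro h
    by_contra! hx
    have := arccos_le_arccos hx
    rw [arccos_cos h0 hπ.le] at this
    linarith
  · intro h
    rcases le_or_gt x (-1) with hx | hx
    · rwa [arccos_of_le_neg_one hx]
    · have := arccos_lt_arccos hx.le h (cos_le_one θ)
      rwa [arccos_cos h0 hπ.le] at this

lemma mem_Ioo_arccos_iff {θ x : ℝ} (hx : 0 ≤ x) :
    θ ∈ Set.Ioo 0 (arccos x) ↔ (0 < θ ∧ θ < π / 2) ∧ x < cos θ := by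
  have h2 : arccos x ≤ π / 2 := arccos_le_pi_div_two.2 hx
  have hpi := pi_pos
  constructor
  · rintro ⟨h1, h3⟩
    exact ⟨⟨h1, by linarith⟩, (lt_arccos_iff_lt_cos h1.le (by linarith)).1 h3⟩
  · rintro ⟨⟨h1, h3⟩, h4⟩
    exact ⟨h1, (lt_arccos_iff_lt_cos h1.le (by linarith)).2 h4⟩

lemma lintegral_Ioo_eq_ofReal_intervalIntegral {f : ℝ → ℝ} {a b : ℝ} (hab : a ≤ b)
    (hf : IntervalIntegrable f volume a b) (h0 : ∀ x ∈ Set.Ioo a b, 0 ≤ f x) :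
    ∫⁻ x in Set.Ioo a b, ENNReal.ofReal (f x) = ENNReal.ofReal (∫ x in a..b, f x) := by
  rw [intervalIntegral.integral_of_le hab, integral_Ioc_eq_integral_Ioo,
    ofReal_integral_eq_lintegral_ofReal]
  · exact ((intervalIntegrable_iff_integrableOn_Ioc_of_le hab).1 hf).mono_set
      Set.Ioo_subset_Ioc_self
  · exact (ae_restrict_iff' measurableSet_Ioo).2 (ae_of_all _ h0)

/-- The Abel-type integral `∫₀^{arccos z} cos θ / √(cos² θ - z²) dθ` does not depend on `z`. -/
lemma lintegral_cos_div_sqrt {z : ℝ} (h0 : 0 ≤ z) (h1 : z < 1) :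
    ∫⁻ θ in Set.Ioo 0 (arccos z), ENNReal.ofReal (cos θ / √(cos θ ^ 2 - z ^ 2))
      = ENNReal.ofReal (π / 2) := by
  have hz : 0 < 1 - z ^ 2 := by nlinarith
  set w := √(1 - z ^ 2) with hw
  have hw0 : 0 < w := Real.sqrt_pos.2 hz
  have hw2 : w ^ 2 = 1 - z ^ 2 := Real.sq_sqrt hz.le
  have hle : 0 ≤ arccos z := arccos_nonneg z
  have hcont : ContinuousOn (fun θ => arcsin (sin θ / w)) (Set.Icc 0 (arccos z)) := by
    fun_prop
  have hder : ∀ θ ∈ Set.Ioo 0 (arccos z),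
      HasDerivAt (fun θ => arcsin (sin θ / w)) (cos θ / √(cos θ ^ 2 - z ^ 2)) θ := by
    intro θ hθ
    obtain ⟨⟨h2, h3⟩, h4⟩ := (mem_Ioo_arccos_iff h0).1 hθ
    have hs : 0 < sin θ := sin_pos_of_pos_of_lt_pi h2 (by linarith)
    have hsc := sin_sq_add_cos_sq θ
    have hsw : sin θ < w := by
      apply lt_of_pow_lt_pow_left₀ 2 hw0.le
      nlinarith
    have hlt : sin θ / w < 1 := (div_lt_one hw0).2 hsw
    have hpos : 0 < sin θ / w := by positivity
    have := (hasDerivAt_arcsin (x := sin θ / w) (by linarith) hlt.ne).comp θ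
      ((hasDerivAt_sin θ).div_const w)
    refine this.congr_deriv ?_
    have he : 1 - (sin θ / w) ^ 2 = (cos θ ^ 2 - z ^ 2) / w ^ 2 := by
      field_simp
      linarith
    have hp : 0 < √(cos θ ^ 2 - z ^ 2) := Real.sqrt_pos.2 (by nlinarith)
    rw [he, Real.sqrt_div' _ (by positivity), Real.sqrt_sq hw0.le]
    field_simp
  have hnn : ∀ θ ∈ Set.Ioo 0 (arccos z), 0 ≤ cos θ / √(cos θ ^ 2 - z ^ 2) := by
    intro θ hθ
    obtain ⟨_, h4⟩ := (mem_Ioo_arccos_iff h0).1 hθ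
    have : 0 < cos θ := by linarith
    positivity
  have hint := (intervalIntegrable_iff_integrableOn_Ioc_of_le hle).2
    (intervalIntegral.integrableOn_deriv_of_nonneg hcont hder hnn)
  rw [lintegral_Ioo_eq_ofReal_intervalIntegral hle hint hnn,
    intervalIntegral.integral_eq_sub_of_hasDerivAt_of_le hle hcont hder hint]
  simp only [sin_arccos, ← hw, div_self hw0.ne', arcsin_one, sin_zero, zero_div, arcsin_zero,
    sub_zero]

lemma lintegral_cos_pow_eq_lintegral_sqrt (m : ℕ) {x t : ℝ} (hx : 0 ≤ x) (hxt : x < t)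
    (ht : t ≤ 1) :
    ENNReal.ofReal (t ^ (m + 1) * ∫ φ in (0 : ℝ)..arccos (x / t), cos φ ^ m)
      = ∫⁻ z in Set.Ioo x t, ENNReal.ofReal (z ^ m) * ENNReal.ofReal (t / √(t ^ 2 - z ^ 2)) := by
  have ht0 : 0 < t := by linarith
  have hxt0 : 0 ≤ x / t := by positivity
  have hpi := pi_pos
  have hmem : ∀ φ ∈ Set.Ioo 0 (arccos (x / t)),
      0 < cos φ ∧ 0 < sin φ ∧ x < t * cos φ := by
    intro φ hφ
    obtain ⟨⟨h2, h3⟩, h4⟩ := (mem_Ioo_arccos_iff hxt0).1 hφ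
    refine ⟨by linarith, sin_pos_of_pos_of_lt_pi h2 (by linarith), ?_⟩
    rw [div_lt_iff₀ ht0] at h4
    linarith
  have himg : (fun φ => t * cos φ) '' Set.Ioo 0 (arccos (x / t)) = Set.Ioo x t := by
    ext z
    constructor
    · rintro ⟨φ, hφ, rfl⟩
      obtain ⟨h1, h2, h3⟩ := hmem φ hφ
      refine ⟨h3, ?_⟩
      have : cos φ < 1 := by nlinarith [sin_sq_add_cos_sq φ]
      show t * cos φ < t
      nlinarith
    · rintro ⟨h1, h2⟩
      have hz1 : z / t < 1 := (div_lt_one ht0).2 h2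
      have hz2 : x / t < z / t := by gcongr
      refine ⟨arccos (z / t), ⟨arccos_pos.2 hz1, arccos_lt_arccos (by linarith) hz2 hz1.le⟩, ?_⟩
      show t * cos (arccos (z / t)) = z
      rw [cos_arccos (by linarith) hz1.le]
      field_simp
  have hinj : Set.InjOn (fun φ => t * cos φ) (Set.Ioo 0 (arccos (x / t))) := by
    intro φ hφ ψ hψ h
    have h' : cos φ = cos ψ := mul_left_cancel₀ ht0.ne' h
    have := arccos_le_pi (x / t)
    exact injOn_cos ⟨hφ.1.le, by linarith [hφ.2]⟩ ⟨hψ.1.le, by linarith [hψ.2]⟩ h'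
  rw [← himg, lintegral_image_eq_lintegral_abs_deriv_mul measurableSet_Ioo
    (fun φ _ => ((hasDerivAt_cos φ).const_mul t).hasDerivWithinAt) hinj,
    ← intervalIntegral.integral_const_mul,
    ← lintegral_Ioo_eq_ofReal_intervalIntegral (arccos_nonneg _)
      (Continuous.intervalIntegrable (by fun_prop) _ _)]
  · refine setLIntegral_congr_fun measurableSet_Ioo fun φ hφ => ?_
    obtain ⟨h1, h2, h3⟩ := hmem φ hφ
    rw [← ENNReal.ofReal_mul (by positivity), ← ENNReal.ofReal_mul (abs_nonneg _)]
    congr 1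
    have he : t ^ 2 - (t * cos φ) ^ 2 = (t * sin φ) ^ 2 := by
      rw [mul_pow, mul_pow, sin_sq]; ring
    rw [he, Real.sqrt_sq (by positivity), mul_neg, abs_neg, abs_of_pos (by positivity)]
    field_simp
    ring
  · intro φ hφ
    have := (hmem φ hφ).1
    positivity

lemma lintegral_cos_pow_mul_integral_cos_pow (m : ℕ) {x : ℝ} (hx : 0 ≤ x) (hx1 : x < 1) :
    ∫⁻ θ in Set.Ioo 0 (arccos x), ENNReal.ofReal (cos θ ^ (m + 1) *
        ((m + 1 : ℝ) * ∫ φ in (0 : ℝ)..arccos (x / cos θ), cos φ ^ m))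
      = ENNReal.ofReal (π / 2 * (1 - x ^ (m + 1))) := by
  set F : ℝ → ℝ → ENNReal := fun θ z =>
    {p : ℝ × ℝ | ((0 < p.1 ∧ p.1 < π / 2) ∧ p.2 < cos p.1) ∧ x < p.2}.indicator
      (fun p => ENNReal.ofReal (p.2 ^ m) *
        ENNReal.ofReal (cos p.1 / √(cos p.1 ^ 2 - p.2 ^ 2))) (θ, z) with hF
  have hmeas : Measurable (Function.uncurry F) := by
    refine Measurable.indicator (by fun_prop) ?_
    refine MeasurableSet.inter (MeasurableSet.inter (MeasurableSet.inter ?_ ?_) ?_) ?_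
    · exact measurableSet_lt measurable_const measurable_fst
    · exact measurableSet_lt measurable_fst measurable_const
    · exact measurableSet_lt measurable_snd (by fun_prop)
    · exact measurableSet_lt measurable_const measurable_snd
  have hleft : ∫⁻ θ, ∫⁻ z, F θ z = ∫⁻ θ in Set.Ioo 0 (arccos x),
      ENNReal.ofReal (cos θ ^ (m + 1) * ∫ φ in (0 : ℝ)..arccos (x / cos θ), cos φ ^ m) := by
    rw [← lintegral_indicator measurableSet_Ioo]
    refine lintegral_congr fun θ => ?_
    by_cases hθ : θ ∈ Set.Ioo 0 (arccos x)
    · rw [Set.indicator_of_mem hθ]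
      obtain ⟨h1, h2⟩ := (mem_Ioo_arccos_iff hx).1 hθ
      rw [lintegral_cos_pow_eq_lintegral_sqrt m hx h2 (cos_le_one θ),
        ← lintegral_indicator measurableSet_Ioo]
      refine lintegral_congr fun z => ?_
      simp only [hF, Set.indicator, Set.mem_ofPred_eq, Set.mem_Ioo]
      congr 1
      simp only [h1, true_and, and_comm, and_true]
    · rw [Set.indicator_of_notMem hθ, lintegral_eq_zero_of_ae_eq_zero]
      refine ae_of_all _ fun z => Set.indicator_of_notMem ?_ _
      rintro ⟨⟨h1, h2⟩, h3⟩
      exact hθ ((mem_Ioo_arccos_iff hx).2 ⟨h1, lt_trans h3 h2⟩)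
  have hright : ∫⁻ z, ∫⁻ θ, F θ z
      = ∫⁻ z in Set.Ioo x 1, ENNReal.ofReal (z ^ m) * ENNReal.ofReal (π / 2) := by
    rw [← lintegral_indicator measurableSet_Ioo]
    refine lintegral_congr fun z => ?_
    by_cases hz : z ∈ Set.Ioo x 1
    · have hz0 : 0 ≤ z := hx.trans hz.1.le
      rw [Set.indicator_of_mem hz, ← lintegral_cos_div_sqrt hz0 hz.2,
        ← lintegral_const_mul _ (by fun_prop), ← lintegral_indicator measurableSet_Ioo]
      refine lintegral_congr fun θ => ?_
      simp only [hF, Set.indicator, Set.mem_ofPred_eq, mem_Ioo_arccos_iff hz0, hz.1, and_true]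
    · rw [Set.indicator_of_notMem hz, lintegral_eq_zero_of_ae_eq_zero]
      refine ae_of_all _ fun θ => Set.indicator_of_notMem ?_ _
      rintro ⟨⟨⟨h0, h1⟩, h2⟩, h3⟩
      exact hz ⟨h3, lt_of_lt_of_le h2 (cos_le_one θ)⟩
  have hm : (0 : ℝ) ≤ m + 1 := by positivity
  calc _ = ∫⁻ θ in Set.Ioo 0 (arccos x), ENNReal.ofReal (m + 1) *
      ENNReal.ofReal (cos θ ^ (m + 1) * ∫ φ in (0 : ℝ)..arccos (x / cos θ), cos φ ^ m) := by
        refine lintegral_congr fun θ => ?_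
        rw [← ENNReal.ofReal_mul hm]
        congr 1; ring
    _ = ENNReal.ofReal (m + 1) * (ENNReal.ofReal (∫ z in x..1, z ^ m) *
          ENNReal.ofReal (π / 2)) := by
        rw [lintegral_const_mul' _ _ ENNReal.ofReal_ne_top, ← hleft,
          lintegral_lintegral_swap hmeas.aemeasurable, hright,
          lintegral_mul_const _ (by fun_prop),
          lintegral_Ioo_eq_ofReal_intervalIntegral hx1.le
            (Continuous.intervalIntegrable (by fun_prop) _ _)
            fun z hz => pow_nonneg (hx.trans hz.1.le) m]
    _ = _ := by
        rw [← ENNReal.ofReal_mul' (by positivity), ← ENNReal.ofReal_mul hm, integral_pow]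
        congr 1
        rw [one_pow]
        field_simp

lemma lintegral_cos_pow_mul_abel_kernel (m : ℕ) {p q : ℝ} (hq : 0 ≤ q) (hqp : q < p) :
    ∫⁻ θ in Set.Ioo 0 (arccos (q / p)), ENNReal.ofReal (cos θ ^ (m + 1) *
        (p / p ^ (m + 1) * ((q / cos θ) ^ (m + 1) *
          (p ^ 2 - (q / cos θ) ^ 2) ^ (-(1 / 2) : ℝ))))
      = ENNReal.ofReal (π / 2 * (q / p) ^ (m + 1)) := by
  have hp : 0 < p := by linarith
  have hx : 0 ≤ q / p := by positivity
  rw [mul_comm (π / 2), ENNReal.ofReal_mul (by positivity),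
    ← lintegral_cos_div_sqrt hx ((div_lt_one hp).2 hqp),
    ← lintegral_const_mul _ (by fun_prop)]
  refine setLIntegral_congr_fun measurableSet_Ioo fun θ hθ => ?_
  obtain ⟨_, h⟩ := (mem_Ioo_arccos_iff hx).1 hθ
  have hc : 0 < cos θ := by linarith
  rw [← ENNReal.ofReal_mul (by positivity)]
  congr 1
  have hd : 0 < cos θ ^ 2 - (q / p) ^ 2 := by nlinarith
  have he : p ^ 2 - (q / cos θ) ^ 2 = (p / cos θ) ^ 2 * (cos θ ^ 2 - (q / p) ^ 2) := by
    field_simp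
  have hs : 0 < √(cos θ ^ 2 - (q / p) ^ 2) := Real.sqrt_pos.2 hd
  rw [he, Real.rpow_neg (by positivity), ← Real.sqrt_eq_rpow, Real.sqrt_mul (by positivity),
    Real.sqrt_sq (by positivity)]
  generalize √(cos θ ^ 2 - (q / p) ^ 2) = S at *
  simp only [div_pow]
  field_simp

lemma restrict_Ioc_eq_of_forall_Ioc_eq {μ ν : Measure ℝ} [IsFiniteMeasure μ] {a b : ℝ}
    (hab : a < b) (h : ∀ r, a ≤ r → r < b → μ (Set.Ioc r b) = ν (Set.Ioc r b)) :
    μ.restrict (Set.Ioc a b) = ν.restrict (Set.Ioc a b) := by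
  refine ext_of_generate_finite _ ((BorelSpace.measurable_eq).trans (borel_eq_generateFrom_Ioi ℝ))
    isPiSystem_Ioi ?_ ?_
  · rintro _ ⟨t, rfl⟩
    rw [Measure.restrict_apply measurableSet_Ioi, Measure.restrict_apply measurableSet_Ioi,
      Set.inter_comm, Set.Ioc_inter_Ioi]
    rcases lt_or_ge (a ⊔ t) b with hb | hb
    · exact h _ le_sup_left hb
    · rw [Set.Ioc_eq_empty hb.not_gt, measure_empty, measure_empty]
  · rw [Measure.restrict_apply_univ, Measure.restrict_apply_univ]
    exact h a le_rfl hab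

/-- Image of `ν ⊗ cosⁿ θ dθ` (with `0 < θ < π / 2`) under the map sending a radius `R` and a
distance `θ` (in the rescaled unit sphere) to the radius of the corresponding section. -/
noncomputable def sectionMeasure (s : ℝ) (n : ℕ) (ν : Measure ℝ) : Measure ℝ :=
  (ν.prod ((volume.restrict (Set.Ioo 0 (π / 2))).withDensity
    fun θ => ENNReal.ofReal (cos θ ^ n))).map
      fun p => 1 / s * arccos (cos (s * p.1) / cos p.2)

lemma sectionRadius_mem_Ioc_iff {s l a q θ : ℝ} (hs : 0 < s) (hl : s * l = π / 2) (ha : 0 ≤ a)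
    (hal : a < l) (hq : 0 ≤ q) (hθ : θ ∈ Set.Ioo 0 (π / 2)) :
    1 / s * arccos (q / cos θ) ∈ Set.Ioc a l ↔ θ ∈ Set.Ioo 0 (arccos (q / cos (s * a))) := by
  have hpi := pi_pos
  have hsa : s * a < π / 2 := hl ▸ mul_lt_mul_of_pos_left hal hs
  have hsa0 : 0 ≤ s * a := by positivity
  have hp : 0 < cos (s * a) := cos_pos_of_mem_Ioo ⟨by linarith, hsa⟩
  have hc : 0 < cos θ := cos_pos_of_mem_Ioo ⟨by linarith [hθ.1], hθ.2⟩
  have h1 : arccos (q / cos θ) ≤ s * l := by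
    rw [hl, arccos_le_pi_div_two]; positivity
  have h2 : 1 / s * arccos (q / cos θ) ≤ l := by
    rw [one_div_mul_eq_div, div_le_iff₀ hs]; linarith
  have h3 : a < 1 / s * arccos (q / cos θ) ↔ s * a < arccos (q / cos θ) := by
    rw [one_div_mul_eq_div, lt_div_iff₀ hs, mul_comm]
  rw [mem_Ioo_arccos_iff (by positivity), Set.mem_Ioc, h3,
    lt_arccos_iff_lt_cos hsa0 (by linarith), div_lt_iff₀ hc, div_lt_iff₀ hp, mul_comm]
  simp only [h2, hθ.1, hθ.2, and_true, true_and]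

lemma setLIntegral_sectionMeasure {s l a : ℝ} (hs : 0 < s) (hl : s * l = π / 2) (n : ℕ)
    {ν : Measure ℝ} [IsFiniteMeasure ν] (hν : ν (Set.Ioc 0 l)ᶜ = 0) (ha : 0 ≤ a) (hal : a < l)
    {Φ : ℝ → ENNReal} (hΦ : Measurable Φ) :
    ∫⁻ y in Set.Ioc a l, Φ y ∂(sectionMeasure s n ν)
      = ∫⁻ R in Set.Ioc a l, (∫⁻ θ in Set.Ioo 0 (arccos (cos (s * R) / cos (s * a))),
          ENNReal.ofReal (cos θ ^ n) * Φ (1 / s * arccos (cos (s * R) / cos θ))) ∂ν := by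
  have hpi := pi_pos
  have hsa : s * a < π / 2 := hl ▸ mul_lt_mul_of_pos_left hal hs
  have hsa0 : 0 ≤ s * a := by positivity
  have hp : 0 < cos (s * a) := cos_pos_of_mem_Ioo ⟨by linarith, hsa⟩
  have hT : Measurable fun p : ℝ × ℝ => 1 / s * arccos (cos (s * p.1) / cos p.2) :=
    (continuous_arccos.measurable.comp (by fun_prop)).const_mul _
  have hind : Measurable ((Set.Ioc a l).indicator Φ) := hΦ.indicator measurableSet_Ioc
  have hcomp : Measurable fun p : ℝ × ℝ =>
      (Set.Ioc a l).indicator Φ (1 / s * arccos (cos (s * p.1) / cos p.2)) := hind.comp hT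
  have hdens : Measurable fun θ : ℝ => ENNReal.ofReal (cos θ ^ n) := by fun_prop
  rw [← lintegral_indicator measurableSet_Ioc, sectionMeasure, lintegral_map hind hT,
    lintegral_prod _ hcomp.aemeasurable, ← lintegral_indicator measurableSet_Ioc]
  have hae : ∀ᵐ R ∂ν, R ∈ Set.Ioc 0 l := by
    rw [ae_iff]; exact hν
  refine lintegral_congr_ae ?_
  filter_upwards [hae] with R hR
  have hsR : s * R ≤ π / 2 := hl ▸ mul_le_mul_of_nonneg_left hR.2 hs.le
  have hsR0 : 0 ≤ s * R := mul_nonneg hs.le hR.1.le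
  have hq : 0 ≤ cos (s * R) := cos_nonneg_of_mem_Icc ⟨by linarith, hsR⟩
  have hslice : Measurable fun θ =>
      (Set.Ioc a l).indicator Φ (1 / s * arccos (cos (s * R) / cos θ)) :=
    hind.comp ((continuous_arccos.measurable.comp
      (by fun_prop : Measurable fun θ => cos (s * R) / cos θ)).const_mul (1 / s))
  rw [lintegral_withDensity_eq_lintegral_mul _ hdens hslice]
  have hkey := fun θ (hθ : θ ∈ Set.Ioo 0 (π / 2)) =>
    sectionRadius_mem_Ioc_iff hs hl ha hal hq hθ
  have hinner : ∫⁻ θ in Set.Ioo 0 (π / 2), ENNReal.ofReal (cos θ ^ n) *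
      (Set.Ioc a l).indicator Φ (1 / s * arccos (cos (s * R) / cos θ))
      = ∫⁻ θ in Set.Ioo 0 (arccos (cos (s * R) / cos (s * a))),
          ENNReal.ofReal (cos θ ^ n) * Φ (1 / s * arccos (cos (s * R) / cos θ)) := by
    rw [← lintegral_indicator measurableSet_Ioo, ← lintegral_indicator measurableSet_Ioo]
    refine lintegral_congr fun θ => ?_
    by_cases hθ : θ ∈ Set.Ioo 0 (π / 2)
    · rw [Set.indicator_of_mem hθ]
      by_cases hθ' : θ ∈ Set.Ioo 0 (arccos (cos (s * R) / cos (s * a)))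
      · rw [Set.indicator_of_mem hθ', Set.indicator_of_mem ((hkey θ hθ).2 hθ')]
      · rw [Set.indicator_of_notMem hθ',
          Set.indicator_of_notMem fun h => hθ' ((hkey θ hθ).1 h), mul_zero]
    · rw [Set.indicator_of_notMem hθ, Set.indicator_of_notMem]
      exact fun h => hθ ((mem_Ioo_arccos_iff (by positivity)).1 h).1
  simp only [Pi.mul_apply]
  rw [hinner]
  by_cases hRa : R ∈ Set.Ioc a l
  · rw [Set.indicator_of_mem hRa]
  · have hRa' : R ≤ a := not_lt.1 fun h => hRa ⟨h, hR.2⟩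
    have : cos (s * a) ≤ cos (s * R) :=
      cos_le_cos_of_nonneg_of_le_pi hsR0 (by linarith) (by gcongr)
    rw [Set.indicator_of_notMem hRa, arccos_of_one_le ((one_le_div hp).2 this), Set.Ioo_self,
      setLIntegral_empty]

lemma intervalIntegral_neg_symm_cos_pow {s : ℝ} (hs : 0 < s) (n : ℕ) (β : ℝ) :
    ∫ h in (-(1 / s * β))..(1 / s * β), cos (s * h) ^ n
      = 2 / s * ∫ θ in (0 : ℝ)..β, cos θ ^ n := by
  have hint : ∀ u v : ℝ, IntervalIntegrable (fun θ => cos θ ^ n) volume u v := fun u v =>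
    Continuous.intervalIntegrable (by fun_prop) _ _
  have hsym : ∫ θ in (-β)..0, cos θ ^ n = ∫ θ in (0 : ℝ)..β, cos θ ^ n := by
    have := intervalIntegral.integral_comp_neg (a := 0) (b := β) fun θ => cos θ ^ n
    simpa using this.symm
  rw [intervalIntegral.integral_comp_mul_left (fun θ => cos θ ^ n) hs.ne',
    show s * -(1 / s * β) = -β by field_simp, show s * (1 / s * β) = β by field_simp,
    ← intervalIntegral.integral_add_adjacent_intervals (hint (-β) 0) (hint 0 β), hsym,
    smul_eq_mul]
  ring

/-- The section formula identifies the (rescaled) induced radius distribution. -/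
lemma smul_restrict_eq_sectionMeasure {k l c a : ℝ} (hk : 0 < k) (hl : √k * l = π / 2) (n : ℕ)
    {ν ν' : Measure ℝ} [IsFiniteMeasure ν] [IsFiniteMeasure ν'] (hν : ν (Set.Ioc 0 l)ᶜ = 0)
    (hsec : ∀ r : ℝ, 0 ≤ r → r < l → c * (ν' (Set.Ioc r l)).toReal
      = ∫ R in Set.Ioc r l,
          (∫ h in (-(alphaPos k R r))..(alphaPos k R r), cos (√k * h) ^ n) ∂ν)
    (ha : 0 ≤ a) (hal : a < l) :
    (ENNReal.ofReal c • ν').restrict (Set.Ioc a l)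
      = (ENNReal.ofReal (2 / √k) • sectionMeasure (√k) n ν).restrict (Set.Ioc a l) := by
  have hpi := pi_pos
  have hs : 0 < √k := Real.sqrt_pos.2 hk
  set s := √k with hsdef
  have : IsFiniteMeasure (ENNReal.ofReal c • ν') := ν'.smul_finite ENNReal.ofReal_ne_top
  refine restrict_Ioc_eq_of_forall_Ioc_eq hal fun r har hrl => ?_
  have hr : 0 ≤ r := ha.trans har
  have hsr : s * r < π / 2 := hl ▸ mul_lt_mul_of_pos_left hrl hs
  have hp : 0 < cos (s * r) :=
    cos_pos_of_mem_Ioo ⟨by linarith [mul_nonneg hs.le hr], hsr⟩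
  have hone := setLIntegral_sectionMeasure hs hl n hν hr hrl (Φ := fun _ => 1) measurable_const
  rw [setLIntegral_one] at hone
  have hG : ∀ R, ∫ h in (-(alphaPos k R r))..(alphaPos k R r), cos (s * h) ^ n
      = 2 / s * ∫ θ in (0 : ℝ)..arccos (cos (s * R) / cos (s * r)), cos θ ^ n := fun R =>
    intervalIntegral_neg_symm_cos_pow hs n _
  have hcont : Continuous fun R : ℝ =>
      2 / s * ∫ θ in (0 : ℝ)..arccos (cos (s * R) / cos (s * r)), cos θ ^ n :=
    ((intervalIntegral.continuous_primitive (fun u v =>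
      Continuous.intervalIntegrable (by fun_prop) _ _) 0).comp
        (continuous_arccos.comp (by fun_prop))).const_mul _
  have hcos : ∀ R ∈ Set.Ioc r l, ∀ θ ∈ Set.Icc 0 (arccos (cos (s * R) / cos (s * r))),
      0 ≤ cos θ ^ n := by
    intro R hR θ hθ
    have hsR : s * R ≤ π / 2 := hl ▸ mul_le_mul_of_nonneg_left hR.2 hs.le
    have hq : 0 ≤ cos (s * R) := cos_nonneg_of_mem_Icc
      ⟨by linarith [mul_nonneg hs.le (hr.trans hR.1.le)], hsR⟩
    have : arccos (cos (s * R) / cos (s * r)) ≤ π / 2 :=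
      arccos_le_pi_div_two.2 (by positivity)
    exact pow_nonneg (cos_nonneg_of_mem_Icc ⟨by linarith [hθ.1], by linarith [hθ.2]⟩) n
  rw [Measure.smul_apply, Measure.smul_apply, smul_eq_mul, smul_eq_mul, hone,
    ← ENNReal.ofReal_toReal (measure_ne_top ν' (Set.Ioc r l)),
    ← ENNReal.ofReal_mul' ENNReal.toReal_nonneg, hsec r hr hrl]
  simp only [hG, mul_one]
  rw [ofReal_integral_eq_lintegral_ofReal
      (hcont.integrableOn_Icc.mono_set Set.Ioc_subset_Icc_self)
      ((ae_restrict_iff' measurableSet_Ioc).2 (ae_of_all _ fun R hR =>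
        mul_nonneg (by positivity)
          (intervalIntegral.integral_nonneg (arccos_nonneg _) (hcos R hR)))),
    ← lintegral_const_mul' _ _ ENNReal.ofReal_ne_top]
  refine setLIntegral_congr_fun measurableSet_Ioc fun R hR => ?_
  rw [lintegral_Ioo_eq_ofReal_intervalIntegral (arccos_nonneg _)
      (Continuous.intervalIntegrable (by fun_prop) _ _)
      fun θ hθ => hcos R hR θ (Set.Ioo_subset_Icc_self hθ),
    ← ENNReal.ofReal_mul (by positivity)]

lemma ofReal_mul_setLIntegral_eq {k l c a : ℝ} (hk : 0 < k) (hl : √k * l = π / 2) (n : ℕ)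
    {ν ν' : Measure ℝ} [IsFiniteMeasure ν] [IsFiniteMeasure ν'] (hν : ν (Set.Ioc 0 l)ᶜ = 0)
    (hsec : ∀ r : ℝ, 0 ≤ r → r < l → c * (ν' (Set.Ioc r l)).toReal
      = ∫ R in Set.Ioc r l,
          (∫ h in (-(alphaPos k R r))..(alphaPos k R r), cos (√k * h) ^ n) ∂ν)
    (ha : 0 ≤ a) (hal : a < l) {f : ℝ → ℝ} (hf : Measurable f) :
    ENNReal.ofReal c * ∫⁻ y in Set.Ioc a l, ENNReal.ofReal (f (cos (√k * y))) ∂ν'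
      = ENNReal.ofReal (2 / √k) * ∫⁻ R in Set.Ioc a l,
          (∫⁻ θ in Set.Ioo 0 (arccos (cos (√k * R) / cos (√k * a))),
            ENNReal.ofReal (cos θ ^ n * f (cos (√k * R) / cos θ))) ∂ν := by
  have hpi := pi_pos
  have hs : 0 < √k := Real.sqrt_pos.2 hk
  have hmeas : Measurable fun y => ENNReal.ofReal (f (cos (√k * y))) :=
    (hf.comp (by fun_prop)).ennreal_ofReal
  rw [← smul_eq_mul, ← lintegral_smul_measure, ← Measure.restrict_smul,
    smul_restrict_eq_sectionMeasure hk hl n hν hsec ha hal, Measure.restrict_smul,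
    lintegral_smul_measure, setLIntegral_sectionMeasure hs hl n hν ha hal hmeas, smul_eq_mul]
  congr 1
  refine setLIntegral_congr_fun measurableSet_Ioc fun R hR => ?_
  have hsR : √k * R ≤ π / 2 := hl ▸ mul_le_mul_of_nonneg_left hR.2 hs.le
  have hsaR : √k * a ≤ √k * R := mul_le_mul_of_nonneg_left hR.1.le hs.le
  have hsa0 : 0 ≤ √k * a := by positivity
  have hq : 0 ≤ cos (√k * R) := cos_nonneg_of_mem_Icc ⟨by linarith, hsR⟩
  have hp : 0 < cos (√k * a) :=
    cos_pos_of_mem_Ioo ⟨by linarith, hl ▸ mul_lt_mul_of_pos_left hal hs⟩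
  refine setLIntegral_congr_fun measurableSet_Ioo fun θ hθ => ?_
  obtain ⟨_, hθ2⟩ := (mem_Ioo_arccos_iff (by positivity)).1 hθ
  have hc : 0 < cos θ := lt_of_le_of_lt (by positivity) hθ2
  have hle : cos (√k * R) / cos θ ≤ 1 := by
    rw [div_lt_iff₀ hp] at hθ2
    rw [div_le_one hc]
    nlinarith [cos_le_one (√k * a)]
  have : 0 ≤ cos (√k * R) / cos θ := by positivity
  rw [ENNReal.ofReal_mul (by positivity), ← mul_assoc, mul_one_div_cancel hs.ne', one_mul,
    cos_arccos (by linarith) hle]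

/-- Inversion formula for Wicksell's problem in spaces of positive curvature. -/
theorem wicksell_inversion_pos
    (d : ℕ) (hd : 2 ≤ d) (k : ℝ) (hk : 0 < k)
    (lk : ℝ) (hlk : lk = Real.pi / (2 * Real.sqrt k))
    (νd νd1 : Measure ℝ) [IsProbabilityMeasure νd] [IsProbabilityMeasure νd1]
    (hνd : νd (Set.Ioc 0 lk)ᶜ = 0) (hνd1 : νd1 (Set.Ioc 0 lk)ᶜ = 0)
    (c : ℝ)
    (hc : c = ∫ R in Set.Ioc (0 : ℝ) lk,
        (∫ h in (-R)..R, Real.cos (Real.sqrt k * h) ^ (d - 1)) ∂νd)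
    (hsec : ∀ r : ℝ, 0 ≤ r → r < lk →
      c * (νd1 (Set.Ioc r lk)).toReal
        = ∫ R in Set.Ioc r lk,
            (∫ h in (-(alphaPos k R r))..(alphaPos k R r),
              Real.cos (Real.sqrt k * h) ^ (d - 1)) ∂νd) :
    ∀ a : ℝ, 0 < a → a < lk →
      (νd (Set.Ioc a lk)).toReal
        = (c * Real.sqrt k / Real.pi) *
            (Real.cos (Real.sqrt k * a) ^ ((2 : ℝ) - d) *
              (∫ y in Set.Ioc a lk,
                Real.cos (Real.sqrt k * y) ^ (d - 1) *
                  (Real.cos (Real.sqrt k * a) ^ 2 - Real.cos (Real.sqrt k * y) ^ 2)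
                    ^ (-(1 / 2) : ℝ) ∂νd1)
            + ((d : ℝ) - 1) *
              (∫ y in Set.Ioc a lk,
                (∫ θ in (0 : ℝ)..(Real.arccos
                    (Real.cos (Real.sqrt k * y) / Real.cos (Real.sqrt k * a))),
                  Real.cos θ ^ (d - 2)) ∂νd1)) := by
  intro a ha hal
  obtain ⟨m, rfl⟩ : ∃ m, d = m + 2 := ⟨d - 2, by omega⟩
  simp only [show m + 2 - 1 = m + 1 from rfl, show m + 2 - 2 = m from rfl] at hc hsec ⊢
  have hpi := pi_pos
  have hs : 0 < √k := Real.sqrt_pos.2 hk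
  have hl : √k * lk = π / 2 := by rw [hlk]; field_simp
  have hsa : √k * a < π / 2 := hl ▸ mul_lt_mul_of_pos_left hal hs
  have hsa0 : 0 < √k * a := by positivity
  set p := cos (√k * a) with hpdef
  have hp : 0 < p := cos_pos_of_mem_Ioo ⟨by linarith, hsa⟩
  have hq : ∀ R ∈ Set.Ioc a lk, 0 ≤ cos (√k * R) ∧ cos (√k * R) < p := by
    intro R hR
    have h1 : √k * R ≤ π / 2 := hl ▸ mul_le_mul_of_nonneg_left hR.2 hs.le
    have h2 : √k * a < √k * R := mul_lt_mul_of_pos_left hR.1 hs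
    exact ⟨cos_nonneg_of_mem_Icc ⟨by linarith, h1⟩,
      cos_lt_cos_of_nonneg_of_le_pi hsa0.le (by linarith) h2⟩
  have hc0 : 0 ≤ c := by
    rw [hc]
    refine setIntegral_nonneg measurableSet_Ioc fun R hR => ?_
    refine intervalIntegral.integral_nonneg (by linarith [hR.1]) fun h hh => pow_nonneg ?_ _
    have h1 : √k * h ≤ √k * lk := mul_le_mul_of_nonneg_left (hh.2.trans hR.2) hs.le
    have h2 : √k * -lk ≤ √k * h :=
      mul_le_mul_of_nonneg_left ((neg_le_neg hR.2).trans hh.1) hs.le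
    exact cos_nonneg_of_mem_Icc ⟨by linarith, by linarith⟩
  set f₁ : ℝ → ℝ := fun t => p / p ^ (m + 1) * (t ^ (m + 1) * (p ^ 2 - t ^ 2) ^ (-(1 / 2) : ℝ))
    with hf₁
  set f₂ : ℝ → ℝ := fun t => (m + 1 : ℝ) * ∫ θ in (0 : ℝ)..arccos (t / p), cos θ ^ m with hf₂
  have hm₁ : Measurable f₁ := by fun_prop
  have hm₂ : Measurable f₂ :=
    (((intervalIntegral.continuous_primitive (fun u v =>
      Continuous.intervalIntegrable (by fun_prop) _ _) 0).comp
        (continuous_arccos.comp (by fun_prop))).const_mul _).measurable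
  have hnn₁ : ∀ y ∈ Set.Ioc a lk, 0 ≤ f₁ (cos (√k * y)) := by
    intro y hy
    obtain ⟨h1, h2⟩ := hq y hy
    have : 0 ≤ p ^ 2 - cos (√k * y) ^ 2 := by nlinarith
    simp only [hf₁]
    positivity
  have hnn₂ : ∀ y ∈ Set.Ioc a lk, 0 ≤ f₂ (cos (√k * y)) := by
    intro y hy
    obtain ⟨h1, h2⟩ := hq y hy
    refine mul_nonneg (by positivity) (intervalIntegral.integral_nonneg (arccos_nonneg _)
      fun θ hθ => pow_nonneg (cos_nonneg_of_mem_Icc ⟨by linarith [hθ.1], hθ.2.trans ?_⟩) m)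
    exact arccos_le_pi_div_two.2 (by positivity)
  have htoReal : ∀ {f : ℝ → ℝ}, Measurable f → (∀ y ∈ Set.Ioc a lk, 0 ≤ f (cos (√k * y))) →
      c * ∫ y in Set.Ioc a lk, f (cos (√k * y)) ∂νd1
        = (ENNReal.ofReal c *
            ∫⁻ y in Set.Ioc a lk, ENNReal.ofReal (f (cos (√k * y))) ∂νd1).toReal := by
    intro f hf hnn
    rw [integral_eq_lintegral_of_nonneg_ae
        ((ae_restrict_iff' measurableSet_Ioc).2 (ae_of_all _ hnn))
        (hf.comp (by fun_prop)).aestronglyMeasurable,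
      ENNReal.toReal_mul, ENNReal.toReal_ofReal hc0]
  have hI₁ := ofReal_mul_setLIntegral_eq hk hl (m + 1) hνd hsec ha.le hal hm₁
  have hI₂ := ofReal_mul_setLIntegral_eq hk hl (m + 1) hνd hsec ha.le hal hm₂
  have hR₁ : ∀ R ∈ Set.Ioc a lk, ∫⁻ θ in Set.Ioo 0 (arccos (cos (√k * R) / p)),
      ENNReal.ofReal (cos θ ^ (m + 1) * f₁ (cos (√k * R) / cos θ))
      = ENNReal.ofReal (π / 2 * (cos (√k * R) / p) ^ (m + 1)) := fun R hR =>
    lintegral_cos_pow_mul_abel_kernel m (hq R hR).1 (hq R hR).2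
  have hR₂ : ∀ R ∈ Set.Ioc a lk, ∫⁻ θ in Set.Ioo 0 (arccos (cos (√k * R) / p)),
      ENNReal.ofReal (cos θ ^ (m + 1) * f₂ (cos (√k * R) / cos θ))
      = ENNReal.ofReal (π / 2 * (1 - (cos (√k * R) / p) ^ (m + 1))) := by
    intro R hR
    obtain ⟨h1, h2⟩ := hq R hR
    rw [← lintegral_cos_pow_mul_integral_cos_pow m (by positivity) ((div_lt_one hp).2 h2)]
    simp only [hf₂, div_right_comm _ _ p]
  rw [setLIntegral_congr_fun measurableSet_Ioc hR₁] at hI₁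
  rw [setLIntegral_congr_fun measurableSet_Ioc hR₂] at hI₂
  have hsum : ENNReal.ofReal c * (∫⁻ y in Set.Ioc a lk, ENNReal.ofReal (f₁ (cos (√k * y))) ∂νd1)
      + ENNReal.ofReal c * (∫⁻ y in Set.Ioc a lk, ENNReal.ofReal (f₂ (cos (√k * y))) ∂νd1)
      = ENNReal.ofReal (2 / √k) * (ENNReal.ofReal (π / 2) * νd (Set.Ioc a lk)) := by
    rw [hI₁, hI₂, ← mul_add, ← lintegral_add_left (by fun_prop), ← setLIntegral_const]
    congr 1
    refine setLIntegral_congr_fun measurableSet_Ioc fun R hR => ?_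
    obtain ⟨h1, h2⟩ := hq R hR
    have hx1 : (cos (√k * R) / p) ^ (m + 1) ≤ 1 :=
      pow_le_one₀ (by positivity) ((div_lt_one hp).2 h2).le
    rw [← ENNReal.ofReal_add (by positivity) (mul_nonneg (by positivity) (by linarith))]
    congr 1
    ring
  have hfin : ENNReal.ofReal (2 / √k) * (ENNReal.ofReal (π / 2) * νd (Set.Ioc a lk)) ≠ ⊤ :=
    ENNReal.mul_ne_top ENNReal.ofReal_ne_top
      (ENNReal.mul_ne_top ENNReal.ofReal_ne_top (measure_ne_top _ _))
  have hreal : c * (∫ y in Set.Ioc a lk, f₁ (cos (√k * y)) ∂νd1)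
      + c * (∫ y in Set.Ioc a lk, f₂ (cos (√k * y)) ∂νd1)
      = 2 / √k * (π / 2 * (νd (Set.Ioc a lk)).toReal) := by
    rw [htoReal hm₁ hnn₁, htoReal hm₂ hnn₂, ← ENNReal.toReal_add, hsum, ENNReal.toReal_mul,
      ENNReal.toReal_mul, ENNReal.toReal_ofReal (by positivity),
      ENNReal.toReal_ofReal (by positivity)]
    · exact ((ENNReal.add_ne_top).1 (hsum ▸ hfin)).1
    · exact ((ENNReal.add_ne_top).1 (hsum ▸ hfin)).2
  have hpow : p ^ ((2 : ℝ) - (m + 2 : ℕ)) = p / p ^ (m + 1) := by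
    rw [show (2 : ℝ) - (m + 2 : ℕ) = 1 - (m + 1 : ℕ) by push_cast; ring, Real.rpow_sub hp,
      Real.rpow_one, Real.rpow_natCast]
  have hd1 : ((m + 2 : ℕ) : ℝ) - 1 = m + 1 := by push_cast; ring
  simp only [hf₁, hf₂, integral_const_mul] at hreal
  rw [hpow, hd1]
  calc (νd (Set.Ioc a lk)).toReal
      = √k / π * (2 / √k * (π / 2 * (νd (Set.Ioc a lk)).toReal)) := by field_simp
    _ = _ := by rw [← hreal]; ring
end

section
/- (Convergence of the section formula to the Euclidean case, positive curvature.) Let d ≥ 2 be an integer and let ν be a Borel probability measure on (0, ∞) whose support is contained in (0, M] for some M > 0. For 0 < k < (π/(2M))², so that M ≤ π/(2√k) =: l_k, define T_k(r) := [∫_{(0,l_k]} ∫_{−R}^{R} cos^{d−1}(√k·h) dh dν(R)]^{−1} · ∫_{(r,l_k]} ∫_{−α_k(R,r)}^{α_k(R,r)} cos^{d−1}(√k·h) dh dν(R). Then for every r > 0: T_k(r) → (∫_{(r,∞)} √(R² − r²) dν(R)) / (∫_{(0,∞)} R dν(R)) as k ↓ 0. -/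
open MeasureTheory Real Filter

/-- The symmetric integral of a power of `cos (s * h)` is jointly continuous in `s` and the
endpoint. -/
lemma continuous_symm_integral_cos_pow (n : ℕ) :
    Continuous (fun p : ℝ × ℝ => ∫ h in (-p.2)..p.2, Real.cos (p.1 * h) ^ n) := by
  have hc : Continuous (Function.uncurry fun (p : ℝ × ℝ) (h : ℝ) => Real.cos (p.1 * h) ^ n) := by
    unfold Function.uncurry
    fun_prop
  have hsub : (fun p : ℝ × ℝ => ∫ h in (-p.2)..p.2, Real.cos (p.1 * h) ^ n) =
      fun p : ℝ × ℝ => (∫ h in (0 : ℝ)..p.2, Real.cos (p.1 * h) ^ n)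
        - ∫ h in (0 : ℝ)..(-p.2), Real.cos (p.1 * h) ^ n := by
    funext p
    have hi : ∀ a b : ℝ, IntervalIntegrable (fun h => Real.cos (p.1 * h) ^ n) volume a b :=
      fun a b => Continuous.intervalIntegrable (by fun_prop) a b
    exact (intervalIntegral.integral_interval_sub_left (hi _ _) (hi _ _)).symm
  rw [hsub]
  exact (intervalIntegral.continuous_parametric_intervalIntegral_of_continuous hc
      continuous_snd).sub
    (intervalIntegral.continuous_parametric_intervalIntegral_of_continuous hc
      continuous_snd.neg)

lemma norm_symm_integral_cos_pow_le (n : ℕ) (s a : ℝ) :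
    ‖∫ h in (-a)..a, Real.cos (s * h) ^ n‖ ≤ 2 * |a| := by
  have h := intervalIntegral.norm_integral_le_of_norm_le_const (a := -a) (b := a) (C := 1)
    (f := fun h => Real.cos (s * h) ^ n) (fun h _ => by
      rw [norm_pow]
      exact pow_le_one₀ (norm_nonneg _) (Real.abs_cos_le_one _))
  calc _ ≤ 1 * |a - -a| := h
    _ = 2 * |a| := by
      rw [one_mul, sub_neg_eq_add, ← two_mul, abs_mul, abs_two]

lemma sqrt_mul_lt_pi_div_two {k M : ℝ} (hM : 0 < M)
    (hk : k ∈ Set.Ioo 0 ((Real.pi / (2 * M)) ^ 2)) : Real.sqrt k * M < Real.pi / 2 := by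
  have h : Real.sqrt k < Real.pi / (2 * M) := (Real.sqrt_lt' (by positivity)).2 hk.2
  calc Real.sqrt k * M < Real.pi / (2 * M) * M := by gcongr
    _ = Real.pi / 2 := by field_simp

lemma abs_alphaPos_le {k r R : ℝ} (hk : 0 < k) (hr : 0 ≤ r) (hrR : r ≤ R)
    (hR : Real.sqrt k * R < Real.pi / 2) : |alphaPos k R r| ≤ R := by
  have hs : 0 < Real.sqrt k := Real.sqrt_pos.2 hk
  have hle : Real.sqrt k * r ≤ Real.sqrt k * R := by gcongr
  have h0 : 0 ≤ Real.sqrt k * r := by positivity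
  have hcr : 0 < Real.cos (Real.sqrt k * r) :=
    Real.cos_pos_of_mem_Ioo ⟨by linarith [Real.pi_pos], by linarith⟩
  have hcR : 0 < Real.cos (Real.sqrt k * R) :=
    Real.cos_pos_of_mem_Ioo ⟨by linarith [Real.pi_pos], hR⟩
  have hq : Real.cos (Real.sqrt k * R) ≤
      Real.cos (Real.sqrt k * R) / Real.cos (Real.sqrt k * r) :=
    le_div_self hcR.le hcr (Real.cos_le_one _)
  have harc := Real.arccos_le_arccos hq
  rw [Real.arccos_cos (by linarith) (by linarith [Real.pi_pos])] at harc
  unfold alphaPos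
  rw [abs_of_nonneg (mul_nonneg (by positivity) (Real.arccos_nonneg _)), one_div,
    inv_mul_le_iff₀ hs]
  exact harc

/-- The section radius written without a singularity at zero curvature. -/
lemma alphaPos_eq_mul_dslope {k r R : ℝ} (hk : 0 < k) (hr : 0 ≤ r) (hrR : r ≤ R)
    (hR : Real.sqrt k * R < Real.pi / 2) :
    alphaPos k R r =
      (fun w => w * dslope Real.arcsin 0 (Real.sqrt k * w))
        (Real.sqrt ((R * Real.sinc (Real.sqrt k * R)) ^ 2 -
          (r * Real.sinc (Real.sqrt k * r)) ^ 2) / Real.cos (Real.sqrt k * r)) := by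
  have hs : 0 < Real.sqrt k := Real.sqrt_pos.2 hk
  unfold alphaPos
  generalize Real.sqrt k = s at *
  have hle : s * r ≤ s * R := by gcongr
  have h0 : 0 ≤ s * r := by positivity
  have hcr : 0 < Real.cos (s * r) :=
    Real.cos_pos_of_mem_Ioo ⟨by linarith [Real.pi_pos], by linarith⟩
  have hcR : 0 < Real.cos (s * R) :=
    Real.cos_pos_of_mem_Ioo ⟨by linarith [Real.pi_pos], hR⟩
  have hsinc : ∀ x : ℝ, s * (x * Real.sinc (s * x)) = Real.sin (s * x) := by
    intro x
    by_cases hx : s * x = 0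
    · have : x = 0 := by simpa [hs.ne'] using hx
      simp [this]
    · rw [Real.sinc_of_ne_zero hx, ← mul_assoc, mul_div_cancel₀ _ hx]
  set W := (R * Real.sinc (s * R)) ^ 2 - (r * Real.sinc (s * r)) ^ 2 with hW
  have hy : Real.sqrt (1 - (Real.cos (s * R) / Real.cos (s * r)) ^ 2) =
      s * (Real.sqrt W / Real.cos (s * r)) := by
    have hsq : 1 - (Real.cos (s * R) / Real.cos (s * r)) ^ 2 =
        s ^ 2 * W / Real.cos (s * r) ^ 2 := by
      have hsW : s ^ 2 * W = Real.cos (s * r) ^ 2 - Real.cos (s * R) ^ 2 := by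
        rw [Real.cos_sq', Real.cos_sq', ← hsinc R, ← hsinc r, hW]
        ring
      rw [hsW]
      field_simp
    rw [hsq, Real.sqrt_div' _ (sq_nonneg _), Real.sqrt_sq hcr.le, Real.sqrt_mul (sq_nonneg _),
      Real.sqrt_sq hs.le, mul_div_assoc]
  have hds : ∀ y : ℝ, Real.arcsin y = y * dslope Real.arcsin 0 y := by
    intro y
    have := sub_smul_dslope Real.arcsin 0 y
    simpa using this.symm
  rw [Real.arccos_eq_arcsin (by positivity), hy, hds]
  field_simp

lemma tendsto_alphaPos {r R M : ℝ} (hr : 0 ≤ r) (hrR : r ≤ R) (hM : 0 < M) (hRM : R ≤ M) :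
    Tendsto (fun k => alphaPos k R r)
      (nhdsWithin 0 (Set.Ioo 0 ((Real.pi / (2 * M)) ^ 2)))
      (nhds (Real.sqrt (R ^ 2 - r ^ 2))) := by
  set w : ℝ → ℝ := fun k => Real.sqrt ((R * Real.sinc (Real.sqrt k * R)) ^ 2 -
    (r * Real.sinc (Real.sqrt k * r)) ^ 2) / Real.cos (Real.sqrt k * r) with hw
  have hwc : ContinuousAt w 0 := by
    have := Real.continuous_sinc
    refine ContinuousAt.div (Continuous.continuousAt (by fun_prop))
      (Continuous.continuousAt (by fun_prop)) (by simp)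
  have hw0 : w 0 = Real.sqrt (R ^ 2 - r ^ 2) := by simp [hw]
  have hd : HasDerivAt Real.arcsin 1 0 := by
    simpa using Real.hasDerivAt_arcsin (x := 0) (by norm_num) (by norm_num)
  have hdc : ContinuousAt (dslope Real.arcsin 0) (Real.sqrt 0 * w 0) := by
    simpa using hd.differentiableAt
  have hcomp : ContinuousAt (fun k => w k * dslope Real.arcsin 0 (Real.sqrt k * w k)) 0 :=
    hwc.mul (ContinuousAt.comp (f := fun k => Real.sqrt k * w k) hdc
      (Real.continuous_sqrt.continuousAt.mul hwc))
  have hlim := hcomp.tendsto.mono_left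
    (nhdsWithin_le_nhds (s := Set.Ioo 0 ((Real.pi / (2 * M)) ^ 2)))
  simp only [Real.sqrt_zero, zero_mul, dslope_same, hd.deriv, mul_one, hw0] at hlim
  refine hlim.congr' ?_
  filter_upwards [self_mem_nhdsWithin] with k hk
  refine (alphaPos_eq_mul_dslope hk.1 hr hrR (lt_of_le_of_lt ?_
    (sqrt_mul_lt_pi_div_two hM hk))).symm
  gcongr

/-- Dominated convergence for symmetric spherical integrals over radii, as the curvature tends to
zero. -/
lemma tendsto_setIntegral_symm_integral_cos_pow (n : ℕ) (ν : Measure ℝ) [IsFiniteMeasure ν]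
    {M c : ℝ} (hM : 0 < M) (hν : ν (Set.Ioc 0 M)ᶜ = 0) (a : ℝ → ℝ → ℝ) (b : ℝ → ℝ)
    (ha : ∀ k, Measurable (a k))
    (hbound : ∀ k ∈ Set.Ioo 0 ((Real.pi / (2 * M)) ^ 2), ∀ R ∈ Set.Ioc c M, |a k R| ≤ M)
    (hlim : ∀ R ∈ Set.Ioc c M, Tendsto (fun k => a k R)
      (nhdsWithin 0 (Set.Ioo 0 ((Real.pi / (2 * M)) ^ 2))) (nhds (b R))) :
    Tendsto
      (fun k : ℝ => ∫ R in Set.Ioc c (Real.pi / (2 * Real.sqrt k)),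
        (∫ h in (-(a k R))..(a k R), Real.cos (Real.sqrt k * h) ^ n) ∂ν)
      (nhdsWithin 0 (Set.Ioo 0 ((Real.pi / (2 * M)) ^ 2)))
      (nhds (2 * ∫ R in Set.Ioi c, b R ∂ν)) := by
  have hsupp : ∀ᵐ R ∂ν, R ∈ Set.Ioc 0 M := hν
  have hmem : ∀ᵐ R ∂(ν.restrict (Set.Ioi c)), R ∈ Set.Ioc c M := by
    filter_upwards [ae_restrict_of_ae hsupp, ae_restrict_mem measurableSet_Ioi] with R h1 h2
    exact ⟨h2, h1.2⟩
  rw [← integral_const_mul]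
  have hmain : Tendsto
      (fun k : ℝ => ∫ R in Set.Ioi c,
        (∫ h in (-(a k R))..(a k R), Real.cos (Real.sqrt k * h) ^ n) ∂ν)
      (nhdsWithin 0 (Set.Ioo 0 ((Real.pi / (2 * M)) ^ 2)))
      (nhds (∫ R in Set.Ioi c, 2 * b R ∂ν)) := by
    refine tendsto_integral_filter_of_dominated_convergence (fun _ => 2 * M) ?_ ?_
      (integrable_const _) ?_
    · refine Eventually.of_forall fun k => Measurable.aestronglyMeasurable ?_
      exact (continuous_symm_integral_cos_pow n).measurable.comp
        (measurable_const.prodMk (ha k))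
    · filter_upwards [self_mem_nhdsWithin] with k hk
      filter_upwards [hmem] with R hR
      exact (norm_symm_integral_cos_pow_le n _ _).trans (by linarith [hbound k hk R hR])
    · filter_upwards [hmem] with R hR
      have hs : Tendsto Real.sqrt (nhdsWithin 0 (Set.Ioo 0 ((Real.pi / (2 * M)) ^ 2)))
          (nhds 0) := by
        simpa using (Real.continuous_sqrt.tendsto 0).mono_left nhdsWithin_le_nhds
      have h := ((continuous_symm_integral_cos_pow n).tendsto (0, b R)).comp
        (hs.prodMk_nhds (hlim R hR))
      simpa [Function.comp_def, two_mul] using h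
  refine hmain.congr' ?_
  filter_upwards [self_mem_nhdsWithin] with k hk
  refine setIntegral_congr_set ?_
  have hs : 0 < Real.sqrt k := Real.sqrt_pos.2 hk.1
  have hMk : M ≤ Real.pi / (2 * Real.sqrt k) := by
    rw [le_div_iff₀ (by positivity)]
    linarith [sqrt_mul_lt_pi_div_two hM hk]
  filter_upwards [hsupp] with R hR
  exact propext ⟨fun h => ⟨h, hR.2.trans hMk⟩, fun h => h.1⟩

/-- Convergence of the section formula to the Euclidean case, positive curvature. -/
theorem wicksell_section_tendsto_euclidean_pos
    (d : ℕ) (hd : 2 ≤ d)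
    (ν : Measure ℝ) [IsProbabilityMeasure ν]
    (M : ℝ) (hM : 0 < M) (hν : ν (Set.Ioc 0 M)ᶜ = 0)
    (r : ℝ) (hr : 0 < r) :
    Tendsto
      (fun k : ℝ =>
        (∫ R in Set.Ioc (0 : ℝ) (Real.pi / (2 * Real.sqrt k)),
            (∫ h in (-R)..R, Real.cos (Real.sqrt k * h) ^ (d - 1)) ∂ν)⁻¹ *
          ∫ R in Set.Ioc r (Real.pi / (2 * Real.sqrt k)),
            (∫ h in (-(alphaPos k R r))..(alphaPos k R r),
              Real.cos (Real.sqrt k * h) ^ (d - 1)) ∂ν)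
      (nhdsWithin 0 (Set.Ioo 0 ((Real.pi / (2 * M)) ^ 2)))
      (nhds ((∫ R in Set.Ioi r, Real.sqrt (R ^ 2 - r ^ 2) ∂ν)
        / (∫ R in Set.Ioi (0 : ℝ), R ∂ν))) := by
  have hsupp : ∀ᵐ R ∂ν, R ∈ Set.Ioc 0 M := hν
  have hden := tendsto_setIntegral_symm_integral_cos_pow (d - 1) ν (c := 0) hM hν
    (fun _ R => R) (fun R => R) (fun _ => measurable_id)
    (fun _ _ R hR => by rw [abs_of_pos hR.1]; exact hR.2) (fun _ _ => tendsto_const_nhds)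
  have hnum := tendsto_setIntegral_symm_integral_cos_pow (d - 1) ν (c := r) hM hν
    (fun k R => alphaPos k R r) (fun R => Real.sqrt (R ^ 2 - r ^ 2))
    (fun k => by unfold alphaPos; fun_prop)
    (fun k hk R hR => (abs_alphaPos_le hk.1 hr.le hR.1.le (lt_of_le_of_lt
      (by gcongr; exact hR.2) (sqrt_mul_lt_pi_div_two hM hk))).trans hR.2)
    (fun R hR => tendsto_alphaPos hr.le hR.1.le hM hR.2)
  have hpos : 0 < ∫ R in Set.Ioi (0 : ℝ), R ∂ν := by
    have hint : Integrable (fun R : ℝ => R) ν := by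
      refine Integrable.of_bound measurable_id.aestronglyMeasurable M ?_
      filter_upwards [hsupp] with R hR
      rw [Real.norm_of_nonneg hR.1.le]
      exact hR.2
    have hIoi : ∀ᵐ R ∂ν, R ∈ Set.Ioi (0 : ℝ) := by
      filter_upwards [hsupp] with R hR using hR.1
    rw [Measure.restrict_eq_self_of_ae_mem hIoi, integral_pos_iff_support_of_nonneg_ae
      (by filter_upwards [hIoi] with R hR using le_of_lt hR) hint]
    have hone : ν (Set.Ioi (0 : ℝ)) = 1 := prob_compl_eq_zero_iff measurableSet_Ioi |>.1 hIoi
    exact (hone ▸ one_pos : 0 < ν (Set.Ioi (0 : ℝ))).trans_le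
      (measure_mono fun R hR => ne_of_gt hR)
  have hlim := (hden.inv₀ (by positivity)).mul hnum
  convert hlim using 2
  field_simp
end

section
/- Let d ≥ 2 be an integer, a > 0, and let ν be a Borel probability measure on (0, ∞) with ∫_{(a,∞)} (y² − a²)^{−1/2} dν(y) < ∞. Then lim_{k ↓ 0} √k · cos^{2−d}(√k·a) · ∫_{(a, π/(2√k))} cos^{d−1}(√k·y) · (cos²(√k·a) − cos²(√k·y))^{−1/2} dν(y) = ∫_{(a,∞)} (y² − a²)^{−1/2} dν(y). -/
open MeasureTheory Real Filter

theorem cos_sq_mul_sq_sub_sq_le {A B : ℝ} (hA : 0 ≤ A) (hAB : A ≤ B) (hB : B < π / 2) :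
    cos B ^ 2 * (B ^ 2 - A ^ 2) ≤ cos A ^ 2 - cos B ^ 2 := by
  have hd (s : ℝ) : HasDerivAt (fun s => sin s ^ 2 - cos B ^ 2 * s ^ 2)
      (2 * (sin s * cos s - cos B ^ 2 * s)) s := by
    refine (((hasDerivAt_sin s).pow 2).sub
      ((hasDerivAt_pow 2 s).const_mul (cos B ^ 2))).congr_deriv ?_
    norm_num
    ring
  have hmono : MonotoneOn (fun s => sin s ^ 2 - cos B ^ 2 * s ^ 2) (Set.Icc 0 B) := by
    refine monotoneOn_of_deriv_nonneg (convex_Icc 0 B)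
      (fun s _ => (hd s).continuousAt.continuousWithinAt)
      (fun s _ => (hd s).differentiableAt.differentiableWithinAt) fun s hs => ?_
    rw [interior_Icc] at hs
    rw [(hd s).deriv]
    have hcB : 0 < cos B := cos_pos_of_mem_Ioo ⟨by linarith [hs.1, hs.2, pi_pos], hB⟩
    have hcs : cos B ≤ cos s := cos_le_cos_of_nonneg_of_le_pi hs.1.le (by linarith [pi_pos]) hs.2.le
    have htan : s * cos s ≤ sin s := by
      have h := lt_tan hs.1 (hs.2.trans hB)
      rw [tan_eq_sin_div_cos, lt_div_iff₀ (hcB.trans_le hcs)] at h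
      exact h.le
    have h1 : cos B ^ 2 * s ≤ cos s ^ 2 * s :=
      mul_le_mul_of_nonneg_right (pow_le_pow_left₀ hcB.le hcs 2) hs.1.le
    have h2 := mul_le_mul_of_nonneg_right htan (hcB.trans_le hcs).le
    nlinarith
  have h := hmono ⟨hA, hAB⟩ ⟨hA.trans hAB, le_rfl⟩ hAB
  simp only at h
  nlinarith [sin_sq_add_cos_sq A, sin_sq_add_cos_sq B]

theorem mul_rpow_neg_half_eq {t X : ℝ} (ht : 0 < t) (hX : 0 ≤ X) :
    t * X ^ (-(1 / 2) : ℝ) = (X / t ^ 2) ^ (-(1 / 2) : ℝ) := by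
  rw [div_rpow hX (by positivity), ← rpow_natCast t 2, ← rpow_mul ht.le]
  norm_num [rpow_neg_one]
  ring

theorem norm_spherical_kernel_le {n : ℕ} {a y t : ℝ} (ha : 0 < a) (hay : a < y) (ht : 0 < t)
    (hty : y < π / (2 * t)) :
    ‖t * cos (t * a) ^ ((2 : ℝ) - (n + 2 : ℕ)) * (cos (t * y) ^ (n + 2 - 1) *
      (cos (t * a) ^ 2 - cos (t * y) ^ 2) ^ (-(1 / 2) : ℝ))‖ ≤
      (y ^ 2 - a ^ 2) ^ (-(1 / 2) : ℝ) := by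
  have hA : 0 < t * a := by positivity
  have hAB : t * a < t * y := by gcongr
  have hB : t * y < π / 2 := by
    rw [lt_div_iff₀ (by positivity)] at hty
    linarith
  have hcB : 0 < cos (t * y) := cos_pos_of_mem_Ioo ⟨by linarith [pi_pos], hB⟩
  have hBA : cos (t * y) < cos (t * a) :=
    cos_lt_cos_of_nonneg_of_le_pi hA.le (by linarith [pi_pos]) hAB
  have hcA := hcB.trans hBA
  have hX : 0 < cos (t * a) ^ 2 - cos (t * y) ^ 2 := by nlinarith
  have hY : 0 < y ^ 2 - a ^ 2 := by nlinarith
  have hpow : cos (t * a) ^ ((2 : ℝ) - (n + 2 : ℕ)) = (cos (t * a) ^ n)⁻¹ := by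
    rw [← rpow_natCast (cos (t * a)) n, ← rpow_neg hcA.le]
    push_cast
    congr 1
    ring
  have hratio : (cos (t * a) ^ n)⁻¹ * cos (t * y) ^ n ≤ 1 := by
    rw [inv_mul_le_iff₀ (by positivity), mul_one]
    exact pow_le_pow_left₀ hcB.le hBA.le n
  rw [hpow, norm_of_nonneg (by positivity)]
  have hZ : y ^ 2 - a ^ 2 ≤
      (cos (t * a) ^ 2 - cos (t * y) ^ 2) / (t * cos (t * y)) ^ 2 := by
    rw [le_div_iff₀ (by positivity)]
    linarith [cos_sq_mul_sq_sub_sq_le hA.le hAB.le hB]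
  calc _ = ((cos (t * a) ^ n)⁻¹ * cos (t * y) ^ n) * (t * cos (t * y) *
        (cos (t * a) ^ 2 - cos (t * y) ^ 2) ^ (-(1 / 2) : ℝ)) := by
        rw [show n + 2 - 1 = n + 1 from rfl, pow_succ]
        ring
    _ ≤ 1 * (t * cos (t * y) * (cos (t * a) ^ 2 - cos (t * y) ^ 2) ^ (-(1 / 2) : ℝ)) := by
        gcongr
    _ = ((cos (t * a) ^ 2 - cos (t * y) ^ 2) / (t * cos (t * y)) ^ 2) ^ (-(1 / 2) : ℝ) := by
        rw [one_mul, mul_rpow_neg_half_eq (by positivity) hX.le]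
    _ ≤ _ := rpow_le_rpow_of_nonpos hY hZ (by norm_num)

theorem tendsto_sin_mul_div (y : ℝ) :
    Tendsto (fun t => sin (t * y) / t) (nhdsWithin 0 (Set.Ioi 0)) (nhds y) := by
  have h : HasDerivAt (fun t : ℝ => sin (t * y)) y 0 := by
    simpa using ((hasDerivAt_id (0 : ℝ)).mul_const y).sin
  have h' := h.tendsto_slope.mono_left
    (nhdsWithin_mono 0 (fun t (ht : t ∈ Set.Ioi (0 : ℝ)) => ne_of_gt ht))
  refine h'.congr fun t => ?_
  simp [slope_def_field]

theorem eventually_lt_pi_div (y : ℝ) :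
    ∀ᶠ t : ℝ in nhdsWithin 0 (Set.Ioi 0), y < π / (2 * t) := by
  have h : Tendsto (fun t : ℝ => t * y) (nhdsWithin 0 (Set.Ioi 0)) (nhds 0) :=
    (Continuous.tendsto' (by fun_prop) 0 0 (by simp)).mono_left nhdsWithin_le_nhds
  filter_upwards [h.eventually_lt_const (half_pos pi_pos), self_mem_nhdsWithin] with t h1 ht
  rw [lt_div_iff₀ (mul_pos two_pos ht)]
  linarith

theorem tendsto_spherical_kernel (p : ℝ) (m : ℕ) {a y : ℝ} (ha : 0 < a) (hay : a < y) :
    Tendsto (fun t => t * cos (t * a) ^ p * (cos (t * y) ^ m *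
      (cos (t * a) ^ 2 - cos (t * y) ^ 2) ^ (-(1 / 2) : ℝ)))
      (nhdsWithin 0 (Set.Ioi 0)) (nhds ((y ^ 2 - a ^ 2) ^ (-(1 / 2) : ℝ))) := by
  have hcos (x : ℝ) : Tendsto (fun t => cos (t * x)) (nhdsWithin 0 (Set.Ioi 0)) (nhds 1) :=
    (Continuous.tendsto' (by fun_prop) 0 1 (by simp)).mono_left nhdsWithin_le_nhds
  have hY : 0 < y ^ 2 - a ^ 2 := by nlinarith
  have hquot := (((tendsto_sin_mul_div y).pow 2).sub ((tendsto_sin_mul_div a).pow 2)).rpow_const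
    (p := (-(1 / 2) : ℝ)) (Or.inl hY.ne')
  have hprod := (((hcos a).rpow_const (p := p) (Or.inl one_ne_zero)).mul ((hcos y).pow m)).mul
    hquot
  simp only [one_rpow, one_pow, one_mul] at hprod
  refine hprod.congr' ?_
  filter_upwards [eventually_lt_pi_div y, self_mem_nhdsWithin] with t hty (ht : 0 < t)
  have hAB : t * a < t * y := by gcongr
  have hA : 0 < t * a := by positivity
  have hB : t * y < π / 2 := by
    rw [lt_div_iff₀ (by positivity)] at hty
    linarith
  have hcB : 0 < cos (t * y) := cos_pos_of_mem_Ioo ⟨by linarith [pi_pos], hB⟩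
  have hBA : cos (t * y) < cos (t * a) :=
    cos_lt_cos_of_nonneg_of_le_pi hA.le (by linarith [pi_pos]) hAB
  have hX : 0 ≤ cos (t * a) ^ 2 - cos (t * y) ^ 2 := by nlinarith
  have heq : (sin (t * y) / t) ^ 2 - (sin (t * a) / t) ^ 2 =
      (cos (t * a) ^ 2 - cos (t * y) ^ 2) / t ^ 2 := by
    rw [div_pow, div_pow, ← sub_div, sin_sq, sin_sq]
    ring
  rw [heq, ← mul_rpow_neg_half_eq ht hX]
  ring

/-- Convergence, as the positive curvature tends to zero, of the first term of the
spherical inversion formula to its Euclidean counterpart. -/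
theorem inversion_first_term_tendsto_euclidean
    (d : ℕ) (hd : 2 ≤ d) (a : ℝ) (ha : 0 < a)
    (ν : Measure ℝ) [IsProbabilityMeasure ν] (hν : ν (Set.Ioi 0)ᶜ = 0)
    (hint : Integrable (fun y => (y ^ 2 - a ^ 2) ^ (-(1 / 2) : ℝ))
      (ν.restrict (Set.Ioi a))) :
    Tendsto
      (fun k : ℝ =>
        Real.sqrt k * Real.cos (Real.sqrt k * a) ^ ((2 : ℝ) - d) *
          ∫ y in Set.Ioo a (Real.pi / (2 * Real.sqrt k)),
            Real.cos (Real.sqrt k * y) ^ (d - 1) *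
              (Real.cos (Real.sqrt k * a) ^ 2 - Real.cos (Real.sqrt k * y) ^ 2)
                ^ (-(1 / 2) : ℝ) ∂ν)
      (nhdsWithin 0 (Set.Ioi 0))
      (nhds (∫ y in Set.Ioi a, (y ^ 2 - a ^ 2) ^ (-(1 / 2) : ℝ) ∂ν)) := by
  obtain ⟨n, rfl⟩ := Nat.exists_eq_add_of_le' hd
  have hsqrt : Tendsto Real.sqrt (nhdsWithin 0 (Set.Ioi 0)) (nhdsWithin 0 (Set.Ioi 0)) :=
    tendsto_nhdsWithin_of_tendsto_nhds_of_eventually_within _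
      ((continuous_sqrt.tendsto' 0 0 sqrt_zero).mono_left nhdsWithin_le_nhds)
      (eventually_mem_nhdsWithin.mono fun k hk => sqrt_pos.2 hk)
  let K (t y : ℝ) : ℝ := t * cos (t * a) ^ ((2 : ℝ) - (n + 2 : ℕ)) * (cos (t * y) ^ (n + 2 - 1) *
    (cos (t * a) ^ 2 - cos (t * y) ^ 2) ^ (-(1 / 2) : ℝ))
  have hlim : Tendsto (fun t => ∫ y in Set.Ioi a, (Set.Iio (π / (2 * t))).indicator (K t) y ∂ν)
      (nhdsWithin 0 (Set.Ioi 0))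
      (nhds (∫ y in Set.Ioi a, (y ^ 2 - a ^ 2) ^ (-(1 / 2) : ℝ) ∂ν)) := by
    refine tendsto_integral_filter_of_dominated_convergence _ ?_ ?_ hint ?_
    · refine Eventually.of_forall fun t => ?_
      have hK : Measurable (K t) := by
        unfold K
        fun_prop
      exact (hK.indicator measurableSet_Iio).aestronglyMeasurable
    · filter_upwards [self_mem_nhdsWithin] with t ht
      filter_upwards [ae_restrict_mem measurableSet_Ioi] with y (hy : a < y)
      by_cases hty : y < π / (2 * t)
      · rw [Set.indicator_of_mem (Set.mem_Iio.2 hty)]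
        exact norm_spherical_kernel_le ha hy ht hty
      · rw [Set.indicator_of_notMem (by simpa using hty), norm_zero]
        exact rpow_nonneg (by nlinarith) _
    · filter_upwards [ae_restrict_mem measurableSet_Ioi] with y (hy : a < y)
      refine (tendsto_spherical_kernel ((2 : ℝ) - (n + 2 : ℕ)) (n + 2 - 1) ha hy).congr' ?_
      filter_upwards [eventually_lt_pi_div y] with t hty
      exact (Set.indicator_of_mem (Set.mem_Iio.2 hty) (K t)).symm
  refine (hlim.comp hsqrt).congr fun k => ?_
  simp only [Function.comp_apply]
  rw [setIntegral_indicator measurableSet_Iio, Set.Ioi_inter_Iio]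
  exact integral_const_mul _ _
end

section
/- Let d ≥ 2 be an integer, a > 0, and let ν be a Borel probability measure on (0, ∞). Then lim_{k ↓ 0} ∫_{(a, π/(2√k))} ∫_0^{arccos(cos(√k·y)/cos(√k·a))} cos^{d−2}θ dθ dν(y) = 0. -/
open MeasureTheory Real Filter

/-- The primitive of a power of the cosine is continuous. -/
lemma continuous_integral_cos_pow (n : ℕ) :
    Continuous fun x : ℝ => ∫ θ in (0 : ℝ)..x, Real.cos θ ^ n :=
  intervalIntegral.continuous_primitive
    (fun _ _ => (Real.continuous_cos.pow n).intervalIntegrable _ _) 0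

/-- The primitive of a power of the cosine is bounded by the length of the interval. -/
lemma norm_integral_cos_pow_le (n : ℕ) (x : ℝ) :
    ‖∫ θ in (0 : ℝ)..x, Real.cos θ ^ n‖ ≤ |x| := by
  have h := intervalIntegral.norm_integral_le_of_norm_le_const (a := 0) (b := x) (C := 1)
    (f := fun θ => Real.cos θ ^ n) fun θ _ => by
      rw [norm_pow]
      exact pow_le_one₀ (norm_nonneg _) (Real.abs_cos_le_one θ)
  simpa using h

/-- The ratio of cosines tends to `1` as the curvature vanishes, so its arccosine tends to `0`. -/
lemma tendsto_arccos_cos_div_cos (a y : ℝ) :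
    Tendsto (fun k : ℝ => Real.arccos (Real.cos (Real.sqrt k * y) / Real.cos (Real.sqrt k * a)))
      (nhds 0) (nhds 0) := by
  have h : ContinuousAt
      (fun k : ℝ => Real.arccos (Real.cos (Real.sqrt k * y) / Real.cos (Real.sqrt k * a))) 0 := by
    refine Real.continuous_arccos.continuousAt.comp (ContinuousAt.div ?_ ?_ (by simp))
    all_goals fun_prop
  simpa [ContinuousAt] using h

/-- The second term of the spherical inversion formula vanishes as the positive
curvature tends to zero. -/
theorem inversion_second_term_tendsto_zero
    (d : ℕ) (hd : 2 ≤ d) (a : ℝ) (ha : 0 < a)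
    (ν : Measure ℝ) [IsProbabilityMeasure ν] (hν : ν (Set.Ioi 0)ᶜ = 0) :
    Tendsto
      (fun k : ℝ =>
        ∫ y in Set.Ioo a (Real.pi / (2 * Real.sqrt k)),
          (∫ θ in (0 : ℝ)..(Real.arccos
              (Real.cos (Real.sqrt k * y) / Real.cos (Real.sqrt k * a))),
            Real.cos θ ^ (d - 2)) ∂ν)
      (nhdsWithin 0 (Set.Ioi 0)) (nhds 0) := by
  simp_rw [← integral_indicator measurableSet_Ioo]
  suffices h : Tendsto _ _ (nhds (∫ _ : ℝ, (0 : ℝ) ∂ν)) by rwa [integral_zero] at h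
  refine tendsto_integral_filter_of_dominated_convergence (fun _ => π) ?_ ?_
    (integrable_const _) ?_
  · refine Eventually.of_forall fun k => ?_
    refine (Measurable.indicator ?_ measurableSet_Ioo).aestronglyMeasurable
    refine (continuous_integral_cos_pow (d - 2)).measurable.comp
      (Real.continuous_arccos.measurable.comp ?_)
    fun_prop
  · refine Eventually.of_forall fun k => Eventually.of_forall fun y => ?_
    refine (norm_indicator_le_norm_self _ _).trans ((norm_integral_cos_pow_le _ _).trans ?_)
    rw [abs_of_nonneg (Real.arccos_nonneg _)]
    exact Real.arccos_le_pi _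
  · refine Eventually.of_forall fun y => ?_
    refine squeeze_zero_norm (fun k => (norm_indicator_le_norm_self _ _).trans
      (norm_integral_cos_pow_le _ _)) ?_
    simpa using ((tendsto_arccos_cos_div_cos a y).mono_left nhdsWithin_le_nhds).abs
end
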